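/- arXiv:2508.09427 — 5 statements merged into one kernel-verified Lean document; each statement's English description precedes it below -/
import Mathlib

section
/- For an admissible hypergraph, the normalized hypergraph Laplacian M := D^{-1/2} H E B⁻¹ Hᵀ D^{-1/2} is a symmetric positive semidefinite matrix, and its spectral norm (largest singular value) satisfies ‖M‖₂ ≤ 1. -/
open Matrix

/-- Spectral norm (largest singular value) of a square real matrix, realized as the
operator norm of the induced continuous linear endomorphism of Euclidean space. -/
noncomputable def specNorm {n : ℕ} (M : Matrix (Fin n) (Fin n) ℝ) : ℝ :=
  ‖Matrix.toEuclideanCLM (𝕜 := ℝ) M‖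

/-- A positive semidefinite matrix whose quadratic form is dominated by the squared Euclidean norm
has spectral norm at most one. -/
theorem specNorm_le_one_of_posSemidef {n : ℕ} {M : Matrix (Fin n) (Fin n) ℝ} (hM : M.PosSemidef)
    (h : ∀ x : Fin n → ℝ, x ⬝ᵥ (M *ᵥ x) ≤ x ⬝ᵥ x) : specNorm M ≤ 1 := by
  refine ContinuousLinearMap.opNorm_le_bound _ zero_le_one fun x => ?_
  rw [one_mul]
  refine le_of_sq_le_sq ?_ (norm_nonneg x)
  rw [EuclideanSpace.real_norm_sq_eq, EuclideanSpace.real_norm_sq_eq]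
  simp only [Matrix.ofLp_toEuclideanCLM]
  set v : Fin n → ℝ := x.ofLp
  set y : Fin n → ℝ := M *ᵥ v with hy
  have hsymm : Mᵀ = M := by simpa using hM.isHermitian.eq
  have hvy : v ⬝ᵥ (M *ᵥ y) = y ⬝ᵥ y := by
    rw [Matrix.dotProduct_mulVec, ← Matrix.mulVec_transpose, hsymm]
  have hpos : 0 ≤ (y - v) ⬝ᵥ (M *ᵥ (y - v)) := by
    simpa using hM.dotProduct_mulVec_nonneg (y - v)
  rw [Matrix.mulVec_sub, sub_dotProduct, dotProduct_sub, dotProduct_sub, hvy, ← hy] at hpos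
  have hyM := h y
  have hvM := h v
  rw [← hy] at hvM
  have key : y ⬝ᵥ y ≤ v ⬝ᵥ v := by linarith
  simpa [dotProduct, sq] using key

/-- Cauchy–Schwarz with zero-one weights. -/
theorem sq_sum_mul_le_of_zero_or_one {ι : Type*} [Fintype ι] {a : ι → ℝ}
    (ha : ∀ i, a i = 0 ∨ a i = 1) (u : ι → ℝ) :
    (∑ i, a i * u i) ^ 2 ≤ (∑ i, a i) * ∑ i, a i * u i ^ 2 := by
  refine Finset.sum_sq_le_sum_mul_sum_of_sq_le_mul Finset.univ ?_ ?_ ?_ <;> intro i _ <;>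
    rcases ha i with h | h <;> simp [h, sq_nonneg]

/-- For an admissible hypergraph, the normalized hypergraph Laplacian
`M = D^{-1/2} H E B⁻¹ Hᵀ D^{-1/2}` is symmetric positive semidefinite and its spectral
norm satisfies `‖M‖₂ ≤ 1`. -/
theorem normalized_hypergraph_laplacian_psd_and_norm_le_one
    (n m : ℕ) (H : Matrix (Fin n) (Fin m) ℝ) (w : Fin m → ℝ)
    (hH : ∀ i j, H i j = 0 ∨ H i j = 1)
    (hw : ∀ j, 0 ≤ w j)
    (hdeg : ∀ i, 0 < ∑ j, H i j * w j)
    (hB : ∀ j, 0 < ∑ i, H i j) :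
    let E : Matrix (Fin m) (Fin m) ℝ := Matrix.diagonal w
    let B : Matrix (Fin m) (Fin m) ℝ := Matrix.diagonal (fun j => ∑ i, H i j)
    let Dinvhalf : Matrix (Fin n) (Fin n) ℝ :=
      Matrix.diagonal (fun i => (Real.sqrt (∑ j, H i j * w j))⁻¹)
    let M : Matrix (Fin n) (Fin n) ℝ := Dinvhalf * H * E * B⁻¹ * Hᵀ * Dinvhalf
    M.IsSymm ∧ M.PosSemidef ∧ specNorm M ≤ 1 := by
  intro E B Dinvhalf M
  set c : Fin m → ℝ := fun j => w j * (∑ i, H i j)⁻¹ with hc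
  have hEB : E * B⁻¹ = Matrix.diagonal c := by
    have hBinv : B⁻¹ = Matrix.diagonal (fun j => (∑ i, H i j)⁻¹) := by
      refine Matrix.inv_eq_right_inv ?_
      rw [Matrix.diagonal_mul_diagonal, ← Matrix.diagonal_one]
      exact congrArg _ (funext fun j => mul_inv_cancel₀ (hB j).ne')
    rw [hBinv, Matrix.diagonal_mul_diagonal]
  have hMeq : M = (Dinvhalf * H) * Matrix.diagonal c * (Dinvhalf * H)ᵀ := by
    simp only [M, ← hEB, Matrix.transpose_mul, Dinvhalf, Matrix.diagonal_transpose,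
      Matrix.mul_assoc]
  have hpsd : M.PosSemidef := by
    rw [hMeq]
    have hdiag : (Matrix.diagonal c).PosSemidef :=
      Matrix.PosSemidef.diagonal fun j => mul_nonneg (hw j) (inv_nonneg.2 (hB j).le)
    simpa using hdiag.mul_mul_conjTranspose_same (Dinvhalf * H)
  refine ⟨by simpa [Matrix.IsSymm] using hpsd.isHermitian.eq, hpsd,
    specNorm_le_one_of_posSemidef hpsd fun x => ?_⟩
  set u : Fin n → ℝ := fun i => (Real.sqrt (∑ j, H i j * w j))⁻¹ * x i with hu
  have hHu : (Dinvhalf * H)ᵀ *ᵥ x = fun j => ∑ i, H i j * u i := by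
    ext j
    simp only [Matrix.mulVec, dotProduct, Matrix.transpose_apply, Dinvhalf,
      Matrix.diagonal_mul, hu]
    exact Finset.sum_congr rfl fun i _ => by ring
  have hquad : x ⬝ᵥ (M *ᵥ x) = ∑ j, c j * (∑ i, H i j * u i) ^ 2 := by
    rw [hMeq, ← Matrix.mulVec_mulVec, ← Matrix.mulVec_mulVec, Matrix.dotProduct_mulVec,
      ← Matrix.mulVec_transpose, hHu]
    simp only [dotProduct, Matrix.mulVec_diagonal]
    exact Finset.sum_congr rfl fun j _ => by ring
  calc x ⬝ᵥ (M *ᵥ x) = ∑ j, c j * (∑ i, H i j * u i) ^ 2 := hquad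
    _ ≤ ∑ j, w j * ∑ i, H i j * u i ^ 2 := by
      refine Finset.sum_le_sum fun j _ => ?_
      have hcs := sq_sum_mul_le_of_zero_or_one (fun i => hH i j) u
      rw [hc]
      simp only
      rw [mul_assoc]
      exact mul_le_mul_of_nonneg_left ((inv_mul_le_iff₀ (hB j)).2 hcs) (hw j)
    _ = ∑ i, (∑ j, H i j * w j) * u i ^ 2 := by
      simp only [Finset.mul_sum, Finset.sum_mul]
      rw [Finset.sum_comm]
      exact Finset.sum_congr rfl fun i _ => Finset.sum_congr rfl fun j _ => by ring
    _ = x ⬝ᵥ x := by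
      refine Finset.sum_congr rfl fun i _ => ?_
      simp only [hu]
      rw [mul_pow, inv_pow, Real.sq_sqrt (hdeg i).le, mul_inv_cancel_left₀ (hdeg i).ne', sq]
end

section
/- Let M ∈ ℝ^{n×n} with spectral norm ‖M‖₂ ≤ 1, let W ∈ ℝ^{d×d} with ‖W‖₂ ≤ κ for some κ ∈ [0,1), let φ : ℝ → ℝ be 1-Lipschitz, and let X̃ ∈ ℝ^{n×d}. Then the map T : ℝ^{n×d} → ℝ^{n×d} defined by T(Z) = φ(M Z W + X̃), with φ applied entrywise, is a κ-contraction in the Frobenius norm: for all Z₁, Z₂ ∈ ℝ^{n×d}, ‖T(Z₁) − T(Z₂)‖_F ≤ κ ‖Z₁ − Z₂‖_F. -/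
open Matrix

/-- Frobenius norm of a real matrix. -/
noncomputable def frobNorm {n d : ℕ} (A : Matrix (Fin n) (Fin d) ℝ) : ℝ :=
  Real.sqrt (∑ i, ∑ j, (A i j) ^ 2)

lemma frobNorm_nonneg {n d : ℕ} (A : Matrix (Fin n) (Fin d) ℝ) : 0 ≤ frobNorm A :=
  Real.sqrt_nonneg _

lemma frobNorm_transpose {n d : ℕ} (A : Matrix (Fin n) (Fin d) ℝ) :
    frobNorm Aᵀ = frobNorm A := by
  unfold frobNorm
  rw [Finset.sum_comm]
  rfl

lemma specNorm_nonneg {n : ℕ} (M : Matrix (Fin n) (Fin n) ℝ) : 0 ≤ specNorm M :=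
  norm_nonneg _

open scoped Matrix.Norms.L2Operator in
lemma specNorm_transpose {n : ℕ} (M : Matrix (Fin n) (Fin n) ℝ) :
    specNorm Mᵀ = specNorm M := by
  have h := Matrix.l2_opNorm_conjTranspose M
  rwa [Matrix.conjTranspose_eq_transpose_of_trivial] at h

lemma sum_sq_mulVec_le {n : ℕ} (M : Matrix (Fin n) (Fin n) ℝ) (v : Fin n → ℝ) :
    ∑ i, (M *ᵥ v) i ^ 2 ≤ specNorm M ^ 2 * ∑ i, v i ^ 2 := by
  have h := (Matrix.toEuclideanCLM (𝕜 := ℝ) M).le_opNorm (WithLp.toLp 2 v)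
  rw [Matrix.toEuclideanCLM_toLp] at h
  have h2 := pow_le_pow_left₀ (norm_nonneg _) h 2
  simpa [mul_pow, EuclideanSpace.real_norm_sq_eq, specNorm] using h2

/-- The Frobenius norm is submultiplicative against the spectral norm on the left. -/
lemma frobNorm_mul_le_left {n d : ℕ} (M : Matrix (Fin n) (Fin n) ℝ)
    (A : Matrix (Fin n) (Fin d) ℝ) : frobNorm (M * A) ≤ specNorm M * frobNorm A := by
  unfold frobNorm
  rw [← Real.sqrt_sq (specNorm_nonneg M), ← Real.sqrt_mul (sq_nonneg _)]
  apply Real.sqrt_le_sqrt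
  rw [Finset.sum_comm, Finset.sum_comm (f := fun i j => A i j ^ 2), Finset.mul_sum]
  exact Finset.sum_le_sum fun j _ => sum_sq_mulVec_le M fun i => A i j

/-- The Frobenius norm is submultiplicative against the spectral norm on the right. -/
lemma frobNorm_mul_le_right {n d : ℕ} (A : Matrix (Fin n) (Fin d) ℝ)
    (W : Matrix (Fin d) (Fin d) ℝ) : frobNorm (A * W) ≤ specNorm W * frobNorm A := by
  have h := frobNorm_mul_le_left Wᵀ Aᵀ
  rwa [← Matrix.transpose_mul, frobNorm_transpose, frobNorm_transpose, specNorm_transpose] at h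

lemma frobNorm_map_sub_map_le {n d : ℕ} {φ : ℝ → ℝ} (hφ : ∀ a b : ℝ, |φ a - φ b| ≤ |a - b|)
    (A B : Matrix (Fin n) (Fin d) ℝ) : frobNorm (A.map φ - B.map φ) ≤ frobNorm (A - B) :=
  Real.sqrt_le_sqrt <| Finset.sum_le_sum fun i _ => Finset.sum_le_sum fun j _ =>
    sq_le_sq.mpr (hφ (A i j) (B i j))

/-- If `‖M‖₂ ≤ 1`, `‖W‖₂ ≤ κ` with `0 ≤ κ < 1`, and `φ` is `1`-Lipschitz,
then `T(Z) = φ(M Z W + X̃)` (with `φ` applied entrywise) is a `κ`-contraction in the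
Frobenius norm. -/
theorem ihgnn_map_is_contraction
    (n d : ℕ) (M : Matrix (Fin n) (Fin n) ℝ) (W : Matrix (Fin d) (Fin d) ℝ)
    (κ : ℝ) (hκ0 : 0 ≤ κ) (hκ1 : κ < 1)
    (hM : specNorm M ≤ 1) (hW : specNorm W ≤ κ)
    (φ : ℝ → ℝ) (hφ : ∀ a b : ℝ, |φ a - φ b| ≤ |a - b|)
    (X : Matrix (Fin n) (Fin d) ℝ) :
    ∀ Z₁ Z₂ : Matrix (Fin n) (Fin d) ℝ,
      frobNorm ((M * Z₁ * W + X).map φ - (M * Z₂ * W + X).map φ) ≤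
        κ * frobNorm (Z₁ - Z₂) := by
  intro Z₁ Z₂
  have hdiff : M * Z₁ * W + X - (M * Z₂ * W + X) = M * (Z₁ - Z₂) * W := by
    rw [add_sub_add_right_eq_sub, Matrix.mul_sub, Matrix.sub_mul]
  calc frobNorm ((M * Z₁ * W + X).map φ - (M * Z₂ * W + X).map φ)
      ≤ frobNorm (M * (Z₁ - Z₂) * W) := hdiff ▸ frobNorm_map_sub_map_le hφ _ _
    _ ≤ specNorm W * frobNorm (M * (Z₁ - Z₂)) := frobNorm_mul_le_right _ _
    _ ≤ κ * frobNorm (M * (Z₁ - Z₂)) :=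
        mul_le_mul_of_nonneg_right hW (frobNorm_nonneg _)
    _ ≤ κ * frobNorm (Z₁ - Z₂) := by
        refine mul_le_mul_of_nonneg_left ((frobNorm_mul_le_left _ _).trans ?_) hκ0
        exact mul_le_of_le_one_left (frobNorm_nonneg _) hM
end

section
/- Let M ∈ ℝ^{n×n} be a matrix for which the all-ones vector 1ₙ is an eigenvector, i.e., M 1ₙ = c 1ₙ for some c ∈ ℝ. Let φ : ℝ → ℝ be strictly increasing (in particular injective), let W ∈ ℝ^{d×d}, and let X̃ ∈ ℝ^{n×d} be a matrix whose rows x̃₁, …, x̃ₙ satisfy x̃ᵢ ≠ x̃ⱼ for some i, j ∈ [n]. Then there exists no vector z₀ ∈ ℝ^d such that the constant-row matrix Z* = 1ₙ z₀ᵀ satisfies the fixed-point equation Z* = φ(M Z* W + X̃) (with φ applied entrywise). In other words, the equilibrium cannot collapse all node representations to a single identical feature vector. -/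
open Matrix

/-- Suppose the all-ones vector is an eigenvector of `M` (`M 1ₙ = c 1ₙ`),
`φ` is strictly increasing, and `X̃` has two distinct rows. Then no constant-row matrix
`Z* = 1ₙ z₀ᵀ` can satisfy the fixed-point equation `Z* = φ(M Z* W + X̃)`: the equilibrium
cannot collapse all node representations to a single identical feature vector. -/
theorem no_constant_row_fixed_point
    (n d : ℕ) (M : Matrix (Fin n) (Fin n) ℝ) (c : ℝ)
    (hM : M *ᵥ (fun _ => (1 : ℝ)) = fun _ => c)
    (φ : ℝ → ℝ) (hφ : StrictMono φ)
    (W : Matrix (Fin d) (Fin d) ℝ)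
    (X : Matrix (Fin n) (Fin d) ℝ)
    (hX : ∃ i j : Fin n, X i ≠ X j) :
    ¬ ∃ z₀ : Fin d → ℝ,
        (Matrix.of fun (_ : Fin n) (j : Fin d) => z₀ j) =
          ((M * (Matrix.of fun (_ : Fin n) (j : Fin d) => z₀ j) * W + X).map φ) := by
  rintro ⟨z₀, hz⟩
  obtain ⟨i, j, hij⟩ := hX
  refine hij (funext fun k => ?_)
  set Z : Matrix (Fin n) (Fin d) ℝ := Matrix.of fun _ j => z₀ j with hZ
  have hMZ (a : Fin n) (l : Fin d) : (M * Z) a l = c * z₀ l := by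
    have hrow : ∑ b, M a b = c := by
      simpa [Matrix.mulVec, dotProduct] using congrFun hM a
    simp [Matrix.mul_apply, hZ, ← Finset.sum_mul, hrow]
  have hφZ (a : Fin n) : z₀ k = φ ((M * Z * W) a k + X a k) := congrFun (congrFun hz a) k
  have hMZW : (M * Z * W) i k = (M * Z * W) j k := by
    rw [Matrix.mul_apply, Matrix.mul_apply]
    simp only [hMZ]
  have hsum := hφ.injective ((hφZ i).symm.trans (hφZ j))
  rwa [hMZW, add_right_inj] at hsum
end

section
/- Let M ∈ ℝ^{n×n} be any matrix, K ∈ ℕ, θ₀, …, θ_K ∈ ℝ arbitrary coefficients, and X ∈ ℝ^{n×d} an input feature matrix. Then, setting the hidden dimension d_h = (K+1)d, there exist matrices W ∈ ℝ^{d_h×d_h}, Θ₁ ∈ ℝ^{d×d_h}, Θ₂ ∈ ℝ^{d_h×d}, and b = 0 ∈ ℝ^{d_h} such that: (i) W^{K+1} = 0 (W is nilpotent); (ii) the equation Z = M Z W + X Θ₁ + 1ₙ bᵀ has a unique solution Z* ∈ ℝ^{n×d_h}; and (iii) Z* Θ₂ = (Σ_{k=0}^{K} θ_k M^k) X. Hence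 an implicit hypergraph neural network with identity activation can express every K-order polynomial filter p(X) = (Σ_{k=0}^{K} θ_k M^k) X. -/
open Matrix

open scoped Kronecker

/-- The nilpotent upper shift matrix, with ones exactly on the first superdiagonal. -/
def upperShift (N : ℕ) : Matrix (Fin N) (Fin N) ℝ :=
  Matrix.of fun i j => if (j : ℕ) = i + 1 then 1 else 0

theorem upperShift_pow_apply (N k : ℕ) (i j : Fin N) :
    (upperShift N ^ k) i j = if (j : ℕ) = i + k then 1 else 0 := by
  induction k generalizing i with
  | zero => simp [Matrix.one_apply, Fin.ext_iff, eq_comm]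
  | succ k ih =>
    rw [pow_succ', Matrix.mul_apply]
    simp only [ih]
    simp only [upperShift, Matrix.of_apply]
    by_cases h : (i : ℕ) + 1 < N
    · rw [Finset.sum_eq_single ⟨i + 1, h⟩]
      · simp [add_assoc, add_comm 1 k]
      · intro l _ hl
        have hne : (l : ℕ) ≠ i + 1 := fun h' => hl (Fin.ext h')
        simp [hne]
      · simp
    · have hj : (j : ℕ) ≠ i + (k + 1) := by omega
      rw [if_neg hj]
      refine Finset.sum_eq_zero fun l _ => ?_
      have hl : (l : ℕ) ≠ i + 1 := by omega
      simp [hl]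

theorem upperShift_pow_self (N : ℕ) : upperShift N ^ N = 0 := by
  ext i j
  have h : (j : ℕ) ≠ i + N := by omega
  simp [upperShift_pow_apply, h]

theorem kronecker_one_pow {m p : Type*} [Fintype m] [DecidableEq m] [Fintype p] [DecidableEq p]
    (A : Matrix m m ℝ) (k : ℕ) : (A ⊗ₖ (1 : Matrix p p ℝ)) ^ k = (A ^ k) ⊗ₖ 1 := by
  induction k with
  | zero => simp
  | succ k ih => rw [pow_succ, ih, ← Matrix.mul_kronecker_mul, ← pow_succ, one_mul]

/-- If `W` is nilpotent, the equation `Z = M Z W + B` is solved exactly by the finite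
Neumann series `∑ M ^ k B W ^ k`. -/
theorem eq_mul_mul_add_iff_of_pow_eq_zero {m p : Type*} [Fintype m] [DecidableEq m] [Fintype p]
    [DecidableEq p] (M : Matrix m m ℝ) (W : Matrix p p ℝ) (B Z : Matrix m p ℝ) {N : ℕ}
    (hW : W ^ N = 0) :
    Z = M * Z * W + B ↔ Z = ∑ k ∈ Finset.range N, M ^ k * B * W ^ k := by
  constructor
  · intro h
    have iterate (j : ℕ) :
        Z = M ^ j * Z * W ^ j + ∑ k ∈ Finset.range j, M ^ k * B * W ^ k := by
      induction j with
      | zero => simp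
      | succ j ih =>
        have step : M ^ j * Z * W ^ j = M ^ (j + 1) * Z * W ^ (j + 1) + M ^ j * B * W ^ j := by
          conv_lhs => rw [h]
          rw [pow_succ M, pow_succ' W]
          simp only [Matrix.mul_add, Matrix.add_mul, Matrix.mul_assoc]
        rw [Finset.sum_range_succ, add_comm (∑ k ∈ _, _), ← add_assoc, ← step]
        exact ih
    simpa [hW] using iterate N
  · intro h
    have shifted : M * Z * W = ∑ k ∈ Finset.range N, M ^ (k + 1) * B * W ^ (k + 1) := by
      rw [h, Matrix.mul_sum, Matrix.sum_mul]
      refine Finset.sum_congr rfl fun k _ => ?_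
      rw [pow_succ' M, pow_succ W]
      simp only [Matrix.mul_assoc]
    have telescope := Finset.sum_range_succ' (fun k => M ^ k * B * W ^ k) N
    rw [Finset.sum_range_succ, hW, ← shifted, ← h] at telescope
    simpa using telescope

/-- Every finite sequence of scalar matrices is realized as `Θ₁ W ^ k Θ₂` with `W` nilpotent. -/
theorem exists_nilpotent_realization (d K : ℕ) (θ : Fin (K + 1) → ℝ) :
    ∃ (W : Matrix (Fin ((K + 1) * d)) (Fin ((K + 1) * d)) ℝ)
      (Θ₁ : Matrix (Fin d) (Fin ((K + 1) * d)) ℝ) (Θ₂ : Matrix (Fin ((K + 1) * d)) (Fin d) ℝ),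
      W ^ (K + 1) = 0 ∧ ∀ k : Fin (K + 1), Θ₁ * W ^ (k : ℕ) * Θ₂ = θ k • 1 := by
  let e : Fin ((K + 1) * d) ≃ Fin (K + 1) × Fin d := finProdFinEquiv.symm
  let u : Matrix Unit (Fin (K + 1)) ℝ := Matrix.of fun _ i => if i = 0 then 1 else 0
  let v : Matrix (Fin (K + 1)) Unit ℝ := Matrix.of fun i _ => θ i
  let S := upperShift (K + 1) ⊗ₖ (1 : Matrix (Fin d) (Fin d) ℝ)
  have hpow (k : ℕ) : (S.submatrix e e) ^ k = ((upperShift (K + 1) ^ k) ⊗ₖ 1).submatrix e e := by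
    rw [← kronecker_one_pow]
    exact (map_pow (Matrix.reindexAlgEquiv ℝ ℝ e.symm) S k).symm
  refine ⟨S.submatrix e e, (u ⊗ₖ (1 : Matrix (Fin d) (Fin d) ℝ)).submatrix (Prod.mk ()) e,
    (v ⊗ₖ (1 : Matrix (Fin d) (Fin d) ℝ)).submatrix e (Prod.mk ()), ?_, fun k => ?_⟩
  · rw [hpow, upperShift_pow_self, Matrix.zero_kronecker, Matrix.submatrix_zero]
    rfl
  · have huv : (u * upperShift (K + 1) ^ (k : ℕ) * v) () () = θ k := by
      have hu (j : Fin (K + 1)) :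
          (u * upperShift (K + 1) ^ (k : ℕ)) () j = if j = k then 1 else 0 := by
        simp only [Matrix.mul_apply, u, Matrix.of_apply, ite_mul, one_mul, zero_mul,
          Finset.sum_ite_eq', Finset.mem_univ, if_true]
        simp [upperShift_pow_apply, Fin.ext_iff]
      rw [Matrix.mul_apply]
      simp [hu, v]
    rw [hpow, Matrix.submatrix_mul_equiv, Matrix.submatrix_mul_equiv,
      ← Matrix.mul_kronecker_mul, ← Matrix.mul_kronecker_mul, one_mul, one_mul]
    ext a c
    simp only [Matrix.submatrix_apply, Matrix.kroneckerMap_apply, huv, Matrix.smul_apply,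
      smul_eq_mul]

/-- For any `M ∈ ℝ^{n×n}`, `K ∈ ℕ`, coefficients `θ₀,…,θ_K`, and input
`X ∈ ℝ^{n×d}`, with hidden dimension `d_h = (K+1)d` there exist parameters `W` (nilpotent
with `W^{K+1} = 0`), `Θ₁`, `Θ₂`, and `b = 0` such that the equilibrium equation
`Z = M Z W + X Θ₁ + 1ₙ bᵀ` has a unique solution `Z*`, and `Z* Θ₂ = (Σ_{k=0}^K θ_k M^k) X`.
Hence an IHGNN with identity activation expresses every `K`-order polynomial filter. -/
theorem ihgnn_expresses_polynomial_filters
    (n d K : ℕ) (M : Matrix (Fin n) (Fin n) ℝ) (θ : Fin (K + 1) → ℝ)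
    (X : Matrix (Fin n) (Fin d) ℝ) :
    ∃ (W : Matrix (Fin ((K + 1) * d)) (Fin ((K + 1) * d)) ℝ)
      (Θ₁ : Matrix (Fin d) (Fin ((K + 1) * d)) ℝ)
      (Θ₂ : Matrix (Fin ((K + 1) * d)) (Fin d) ℝ)
      (b : Fin ((K + 1) * d) → ℝ),
      b = 0 ∧
      W ^ (K + 1) = 0 ∧
      (∃! Z : Matrix (Fin n) (Fin ((K + 1) * d)) ℝ,
        Z = M * Z * W + X * Θ₁ + Matrix.vecMulVec (fun _ => (1 : ℝ)) b) ∧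
      (∀ Z : Matrix (Fin n) (Fin ((K + 1) * d)) ℝ,
        Z = M * Z * W + X * Θ₁ + Matrix.vecMulVec (fun _ => (1 : ℝ)) b →
        Z * Θ₂ = (∑ k : Fin (K + 1), θ k • M ^ (k : ℕ)) * X) := by
  obtain ⟨W, Θ₁, Θ₂, hW, hΘ⟩ := exists_nilpotent_realization d K θ
  have hsol (Z : Matrix (Fin n) (Fin ((K + 1) * d)) ℝ) :
      Z = M * Z * W + X * Θ₁ + Matrix.vecMulVec (fun _ => (1 : ℝ)) 0 ↔
        Z = ∑ k ∈ Finset.range (K + 1), M ^ k * (X * Θ₁) * W ^ k := by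
    have hb : Matrix.vecMulVec (fun _ : Fin n => (1 : ℝ)) (0 : Fin ((K + 1) * d) → ℝ) = 0 := by
      ext
      simp [Matrix.vecMulVec_apply]
    rw [hb, add_zero]
    exact eq_mul_mul_add_iff_of_pow_eq_zero M W (X * Θ₁) Z hW
  refine ⟨W, Θ₁, Θ₂, 0, rfl, hW, ⟨_, (hsol _).2 rfl, fun Z hZ => (hsol Z).1 hZ⟩, fun Z hZ => ?_⟩
  rw [(hsol Z).1 hZ, Finset.sum_range, Matrix.sum_mul, Matrix.sum_mul]
  refine Finset.sum_congr rfl fun k _ => ?_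
  calc M ^ (k : ℕ) * (X * Θ₁) * W ^ (k : ℕ) * Θ₂
      = M ^ (k : ℕ) * X * (Θ₁ * W ^ (k : ℕ) * Θ₂) := by simp only [Matrix.mul_assoc]
    _ = θ k • M ^ (k : ℕ) * X := by
      rw [hΘ, Matrix.mul_smul, Matrix.mul_one, Matrix.smul_mul]
end

section
/- Let φ : ℝ → ℝ be positively homogeneous, i.e., φ(αx) = α φ(x) for all α ≥ 0 and x ∈ ℝ, applied entrywise to matrices. Let M ∈ ℝ^{n×n}, W ∈ ℝ^{d_h×d_h}, Θ₁ ∈ ℝ^{d×d_h}, Θ₂ ∈ ℝ^{d_h×d'}, b ∈ ℝ^{d_h}, X ∈ ℝ^{n×d}, and suppose Z* ∈ ℝ^{n×d_h} satisfies Z* = φ(M Z* W + X Θ₁ + 1ₙ bᵀ). Then for every α > 0, the scaled matrix α Z* satisfies the equilibrium equation of the rescaled model with parameters (W, αΘ₁, αb, α⁻¹Θ₂), namely α Z* = φ(M (αZ*) W + X (αΘ₁) + 1ₙ (αb)ᵀ), and the two models produce identical outputs: (α Z*)(α⁻¹ Θ₂) = Z* Θ₂. -/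
open Matrix

/-- Let `φ` be positively homogeneous (`φ(αx) = αφ(x)` for `α ≥ 0`),
applied entrywise. If `Z*` satisfies `Z* = φ(M Z* W + X Θ₁ + 1ₙ bᵀ)`, then for every
`α > 0` the scaled state `αZ*` satisfies the equilibrium equation of the rescaled model
with parameters `(W, αΘ₁, αb, α⁻¹Θ₂)`, and the two models produce identical outputs:
`(αZ*)(α⁻¹Θ₂) = Z* Θ₂`. -/
theorem ihgnn_rescaled_model_equivalence
    (n d dh d' : ℕ) (φ : ℝ → ℝ)
    (hφ : ∀ α : ℝ, 0 ≤ α → ∀ x : ℝ, φ (α * x) = α * φ x)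
    (M : Matrix (Fin n) (Fin n) ℝ) (W : Matrix (Fin dh) (Fin dh) ℝ)
    (Θ₁ : Matrix (Fin d) (Fin dh) ℝ) (Θ₂ : Matrix (Fin dh) (Fin d') ℝ)
    (b : Fin dh → ℝ) (X : Matrix (Fin n) (Fin d) ℝ)
    (Zstar : Matrix (Fin n) (Fin dh) ℝ)
    (hfix : Zstar =
      ((M * Zstar * W + X * Θ₁ + Matrix.vecMulVec (fun _ => (1 : ℝ)) b).map φ)) :
    ∀ α : ℝ, 0 < α →
      (α • Zstar =
        ((M * (α • Zstar) * W + X * (α • Θ₁) +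
          Matrix.vecMulVec (fun _ => (1 : ℝ)) (α • b)).map φ)) ∧
      (α • Zstar) * (α⁻¹ • Θ₂) = Zstar * Θ₂ := by
  intro α hα
  refine ⟨?_, ?_⟩
  · have hlin : M * (α • Zstar) * W + X * (α • Θ₁) +
        Matrix.vecMulVec (fun _ => (1 : ℝ)) (α • b) =
        α • (M * Zstar * W + X * Θ₁ + Matrix.vecMulVec (fun _ => (1 : ℝ)) b) := by
      simp only [Matrix.mul_smul, Matrix.smul_mul, Matrix.vecMulVec_smul, smul_add]
    rw [hlin]
    ext i j
    rw [Matrix.map_apply, Matrix.smul_apply, Matrix.smul_apply, smul_eq_mul, smul_eq_mul,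
      hφ α hα.le, ← Matrix.map_apply (f := φ), ← hfix]
  · rw [Matrix.smul_mul, Matrix.mul_smul, smul_inv_smul₀ hα.ne']
end
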